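/- Suppose |1−χ| = O(ε). Then there exists a positive constant ε₀ depending only on Pr, γ and μ′/μ such that if ε < ε₀, then: inf_{x∈Ω} ρ̃(x) > 3/4, inf_{x∈Ω} 𝒯̃(x) > 3/4, ‖ρ̃ − 1‖_{L∞∩H⁴} ≤ C̃ε, ‖𝒯̃ − 1‖_{L∞∩H⁴} ≤ C̃ε; and for any smooth solution with N̂ = N(T) ≤ 1: inf_{Ω×[0,T]} ρ > 1/2, inf_{Ω×[0,T]} 𝒯 > 1/2, ‖(φ,θ)(t)‖²_{L∞} ≤ C̃N̂ε², ‖ψ(t)‖²_{L∞} ≤ C̃N̂, ‖(∇φ,∇θ)(t)‖²_{L∞} ≤ C̃N̂, and ‖∇ψ(t)‖²_{L∞} ≤ C̃N̂ε⁻² for all t ∈ [0,T], where C̃ depends only on Pr, μ′/μ and γ. -/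

import Mathlib

noncomputable section

open MeasureTheory Real Filter Topology

namespace Couette

/-- The periodic cell of the horizontally periodic layer `Ω = 𝕊¹ × (0,1)`. -/
def Ω : Set (ℝ × ℝ) := {x : ℝ × ℝ | x.1 ∈ Set.Ioo 0 (2 * π) ∧ x.2 ∈ Set.Ioo 0 1}

variable {F : Type*} [NormedAddCommGroup F] [NormedSpace ℝ F]

/-- Partial derivative in the horizontal direction `x₁`. -/
def d1 (f : ℝ × ℝ → F) (x : ℝ × ℝ) : F := fderiv ℝ f x (1, 0)

/-- Partial derivative in the vertical direction `x₂`. -/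
def d2 (f : ℝ × ℝ → F) (x : ℝ × ℝ) : F := fderiv ℝ f x (0, 1)

/-- Time derivative of a time-dependent field. -/
def dt (f : ℝ → ℝ × ℝ → F) (t : ℝ) (x : ℝ × ℝ) : F := deriv (fun s => f s x) t

/-- Divergence of a (two-dimensional) vector field. -/
def divv (v : ℝ × ℝ → ℝ × ℝ) (x : ℝ × ℝ) : ℝ :=
  d1 (fun y => (v y).1) x + d2 (fun y => (v y).2) x

/-- Gradient of a scalar field. -/
def grad (f : ℝ × ℝ → ℝ) (x : ℝ × ℝ) : ℝ × ℝ := (d1 f x, d2 f x)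

/-- Laplacian. -/
def lap (f : ℝ × ℝ → F) (x : ℝ × ℝ) : F := d1 (d1 f) x + d2 (d2 f) x

/-- Euclidean inner product on `ℝ²`. -/
def dot (a b : ℝ × ℝ) : ℝ := a.1 * b.1 + a.2 * b.2

/-- The contraction `𝔇(v) : 𝔇(w)` of deformation tensors, where
`𝔇(v) = (∇v + (∇v)ᵀ)/2`. -/
def defContract (v w : ℝ × ℝ → ℝ × ℝ) (x : ℝ × ℝ) : ℝ :=
  d1 (fun y => (v y).1) x * d1 (fun y => (w y).1) x
    + d2 (fun y => (v y).2) x * d2 (fun y => (w y).2) x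
    + 2 * ((d1 (fun y => (v y).2) x + d2 (fun y => (v y).1) x) / 2)
        * ((d1 (fun y => (w y).2) x + d2 (fun y => (w y).1) x) / 2)

/-- Squared `L²(Ω)` norm of the `j`-th spatial derivative. -/
def dSq (j : ℕ) (f : ℝ × ℝ → F) : ℝ := ∫ x in Ω, ‖iteratedFDeriv ℝ j f x‖ ^ 2

/-- Squared `L²(Ω)` norm. -/
def L2Sq (f : ℝ × ℝ → F) : ℝ := dSq 0 f

/-- Squared `Hᵏ(Ω)` norm. -/
def HSq (k : ℕ) (f : ℝ × ℝ → F) : ℝ := ∑ j ∈ Finset.range (k + 1), dSq j f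

/-- `L∞(Ω)` (sup) norm. -/
def LinfSup (f : ℝ × ℝ → F) : ℝ := ⨆ x ∈ Ω, ‖f x‖

/-- Membership in the Sobolev space `Hᵏ(Ω)`. -/
def MemH (k : ℕ) (f : ℝ × ℝ → F) : Prop :=
  ∀ j ≤ k, IntegrableOn (fun x => ‖iteratedFDeriv ℝ j f x‖ ^ 2) Ω

/-- Continuity in time, with values in `Hᵏ(Ω)`, on the time set `s`. -/
def ContInH (k : ℕ) (f : ℝ → ℝ × ℝ → F) (s : Set ℝ) : Prop :=
  (∀ t ∈ s, MemH k (f t)) ∧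
    ∀ t₀ ∈ s, Tendsto (fun t => HSq k (fun x => f t x - f t₀ x)) (nhdsWithin t₀ s) (nhds 0)

/-- Square integrability in time, with values in `Hᵏ(Ω)`, on the time set `s`. -/
def L2InH (k : ℕ) (f : ℝ → ℝ × ℝ → F) (s : Set ℝ) : Prop :=
  IntegrableOn (fun t => HSq k (f t)) s

/-- Temperature `𝒯̃` of the non-dimensional plane Couette flow
(here `C_p = γ/(γ-1)`, the gas constant being normalized to `R = 1`). -/
def tT (γ Pr ε χ : ℝ) (x : ℝ × ℝ) : ℝ :=
  χ + (1 - χ) * x.2 - ε ^ 2 * Pr / (2 * (γ / (γ - 1))) * (x.2 ^ 2 - x.2)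

/-- Density `ρ̃ = 𝒯̃⁻¹` of the plane Couette flow. -/
def tρ (γ Pr ε χ : ℝ) (x : ℝ × ℝ) : ℝ := (tT γ Pr ε χ x)⁻¹

/-- Velocity `ũ = (x₂, 0)` of the plane Couette flow. -/
def tu (x : ℝ × ℝ) : ℝ × ℝ := (x.2, 0)

/-- Total density `ρ = ρ̃ + φ`. -/
def pρ (γ Pr ε χ : ℝ) (φ : ℝ → ℝ × ℝ → ℝ) (t : ℝ) (x : ℝ × ℝ) : ℝ := tρ γ Pr ε χ x + φ t x

/-- Total temperature `𝒯 = 𝒯̃ + θ`. -/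
def pT (γ Pr ε χ : ℝ) (θ : ℝ → ℝ × ℝ → ℝ) (t : ℝ) (x : ℝ × ℝ) : ℝ := tT γ Pr ε χ x + θ t x

/-- Total velocity `u = ũ + ψ`. -/
def pu (ψ : ℝ → ℝ × ℝ → ℝ × ℝ) (t : ℝ) (x : ℝ × ℝ) : ℝ × ℝ := tu x + ψ t x

/-- A classical solution `(φ, ψ, θ) = (ρ - ρ̃, u - ũ, 𝒯 - 𝒯̃)` of the perturbation
system around the plane Couette flow on `Ω × [0,T]`, with non-slip and isothermal
boundary conditions and periodicity in `x₁`.  Here `μ = 1/Re`, `μ' = r·μ`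
(`r = μ'/μ = ν'/ν`), and `κ = C_p/(Re·Pr)` with `C_p = γ/(γ-1)`. -/
structure PerturbSol (γ Pr r Re ε χ T : ℝ) where
  φ : ℝ → ℝ × ℝ → ℝ
  ψ : ℝ → ℝ × ℝ → ℝ × ℝ
  θ : ℝ → ℝ × ℝ → ℝ
  mass_eq : ∀ t ∈ Set.Icc (0 : ℝ) T, ∀ x ∈ Ω,
    dt φ t x + dot (pu ψ t x) (grad (φ t) x) + pρ γ Pr ε χ φ t x * divv (ψ t) x
      + dot (ψ t x) (grad (tρ γ Pr ε χ) x) = 0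
  mom_eq1 : ∀ t ∈ Set.Icc (0 : ℝ) T, ∀ x ∈ Ω,
    pρ γ Pr ε χ φ t x * ((dt ψ t x).1 + dot (pu ψ t x) (grad (fun y => (ψ t y).1) x)
        + dot (ψ t x) (grad (fun y => (tu y).1) x))
      + (ε ^ 2)⁻¹ * d1 (fun y => pρ γ Pr ε χ φ t y * pT γ Pr ε χ θ t y) x
      - Re⁻¹ * lap (fun y => (ψ t y).1) x
      - (Re⁻¹ + r * Re⁻¹) * d1 (divv (ψ t)) x = 0
  mom_eq2 : ∀ t ∈ Set.Icc (0 : ℝ) T, ∀ x ∈ Ω,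
    pρ γ Pr ε χ φ t x * ((dt ψ t x).2 + dot (pu ψ t x) (grad (fun y => (ψ t y).2) x)
        + dot (ψ t x) (grad (fun y => (tu y).2) x))
      + (ε ^ 2)⁻¹ * d2 (fun y => pρ γ Pr ε χ φ t y * pT γ Pr ε χ θ t y) x
      - Re⁻¹ * lap (fun y => (ψ t y).2) x
      - (Re⁻¹ + r * Re⁻¹) * d2 (divv (ψ t)) x = 0
  energy_eq : ∀ t ∈ Set.Icc (0 : ℝ) T, ∀ x ∈ Ω,
    pρ γ Pr ε χ φ t x / (γ - 1) * (dt θ t x + dot (pu ψ t x) (grad (θ t) x)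
        + dot (ψ t x) (grad (tT γ Pr ε χ) x))
      + pρ γ Pr ε χ φ t x * pT γ Pr ε χ θ t x * divv (ψ t) x
      - γ / (γ - 1) / (Re * Pr) * lap (θ t) x
      = ε ^ 2 * (2 * Re⁻¹ * defContract (ψ t) (ψ t) x
          + 4 * Re⁻¹ * defContract tu (ψ t) x + r * Re⁻¹ * (divv (ψ t) x) ^ 2)
  bc_ψ : ∀ t ∈ Set.Icc (0 : ℝ) T, ∀ x : ℝ × ℝ, (x.2 = 0 ∨ x.2 = 1) → ψ t x = 0
  bc_θ : ∀ t ∈ Set.Icc (0 : ℝ) T, ∀ x : ℝ × ℝ, (x.2 = 0 ∨ x.2 = 1) → θ t x = 0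
  periodic_φ : ∀ t x, φ t (x.1 + 2 * π, x.2) = φ t x
  periodic_ψ : ∀ t x, ψ t (x.1 + 2 * π, x.2) = ψ t x
  periodic_θ : ∀ t x, θ t (x.1 + 2 * π, x.2) = θ t x

/-- Smoothness (in time and space) of a solution of the perturbation system. -/
def SmoothSol {γ Pr r Re ε χ T : ℝ} (S : PerturbSol γ Pr r Re ε χ T) : Prop :=
  ContDiff ℝ (⊤ : ℕ∞) (Function.uncurry S.φ) ∧ ContDiff ℝ (⊤ : ℕ∞) (Function.uncurry S.ψ) ∧
    ContDiff ℝ (⊤ : ℕ∞) (Function.uncurry S.θ)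

/-- Standing hypotheses on a solution of the perturbation system: initial regularity
`(φ₀, ψ₀, θ₀) ∈ H³`, zero average of the initial density perturbation, and the
compatibility conditions `∂tψ(0) = ∂tθ(0) = 0` on `∂Ω`. -/
def StdHyp {γ Pr r Re ε χ T : ℝ} (S : PerturbSol γ Pr r Re ε χ T) : Prop :=
  MemH 3 (S.φ 0) ∧ MemH 3 (S.ψ 0) ∧ MemH 3 (S.θ 0) ∧
    (∫ x in Ω, S.φ 0 x) = 0 ∧
    ∀ x : ℝ × ℝ, (x.2 = 0 ∨ x.2 = 1) → dt S.ψ 0 x = 0 ∧ dt S.θ 0 x = 0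

/-- The energy functional `A₀`. -/
def A0 (ε : ℝ) (φ : ℝ → ℝ × ℝ → ℝ) (ψ : ℝ → ℝ × ℝ → ℝ × ℝ) (θ : ℝ → ℝ × ℝ → ℝ)
    (t : ℝ) : ℝ :=
  (⨆ s ∈ Set.Icc (0 : ℝ) t,
      (L2Sq (ψ s) + (ε ^ 2)⁻¹ * L2Sq (φ s) + (ε ^ 2)⁻¹ * L2Sq (θ s)))
    + ∫ s in (0 : ℝ)..t, (HSq 1 (ψ s) + (ε ^ 2)⁻¹ * HSq 1 (θ s))

/-- The energy functional `A₁`. -/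
def A1 (ε : ℝ) (φ : ℝ → ℝ × ℝ → ℝ) (ψ : ℝ → ℝ × ℝ → ℝ × ℝ) (θ : ℝ → ℝ × ℝ → ℝ)
    (t : ℝ) : ℝ :=
  (⨆ s ∈ Set.Icc (0 : ℝ) t, (dSq 1 (ψ s) + (ε ^ 2)⁻¹ * dSq 1 (θ s)))
    + ∫ s in (0 : ℝ)..t, (L2Sq (dt ψ s) + (ε ^ 2)⁻¹ * L2Sq (dt θ s))

/-- The energy functional `A₂`. -/
def A2 (ε : ℝ) (φ : ℝ → ℝ × ℝ → ℝ) (ψ : ℝ → ℝ × ℝ → ℝ × ℝ) (θ : ℝ → ℝ × ℝ → ℝ)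
    (t : ℝ) : ℝ :=
  (ε ^ 2)⁻¹ * (⨆ s ∈ Set.Icc (0 : ℝ) t, dSq 1 (φ s))
    + (∫ s in (0 : ℝ)..t, ((ε ^ 4)⁻¹ * HSq 1 (φ s) + (ε ^ 2)⁻¹ * L2Sq (dt φ s)))
    + ∫ s in (0 : ℝ)..t, (HSq 2 (ψ s) + (ε ^ 2)⁻¹ * HSq 2 (θ s))

/-- The energy functional `A₃`. -/
def A3 (ε : ℝ) (φ : ℝ → ℝ × ℝ → ℝ) (ψ : ℝ → ℝ × ℝ → ℝ × ℝ) (θ : ℝ → ℝ × ℝ → ℝ)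
    (t : ℝ) : ℝ :=
  (⨆ s ∈ Set.Icc (0 : ℝ) t,
      ((ε ^ 2)⁻¹ * L2Sq (dt φ s) + L2Sq (dt ψ s) + (ε ^ 2)⁻¹ * L2Sq (dt θ s)))
    + ∫ s in (0 : ℝ)..t, (dSq 1 (dt ψ s) + (ε ^ 2)⁻¹ * dSq 1 (dt θ s))

/-- The energy functional `A₄`. -/
def A4 (ε : ℝ) (φ : ℝ → ℝ × ℝ → ℝ) (ψ : ℝ → ℝ × ℝ → ℝ × ℝ) (θ : ℝ → ℝ × ℝ → ℝ)
    (t : ℝ) : ℝ :=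
  (⨆ s ∈ Set.Icc (0 : ℝ) t,
      ((ε ^ 2)⁻¹ * dSq 2 (φ s) + dSq 2 (ψ s) + (ε ^ 2)⁻¹ * dSq 2 (θ s)))
    + ∫ s in (0 : ℝ)..t, ((ε ^ 4)⁻¹ * HSq 2 (φ s) + HSq 3 (ψ s) + (ε ^ 2)⁻¹ * HSq 3 (θ s))

/-- The energy functional `A₅`. -/
def A5 (ε : ℝ) (φ : ℝ → ℝ × ℝ → ℝ) (ψ : ℝ → ℝ × ℝ → ℝ × ℝ) (θ : ℝ → ℝ × ℝ → ℝ)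
    (t : ℝ) : ℝ :=
  (⨆ s ∈ Set.Icc (0 : ℝ) t,
      ((ε ^ 2)⁻¹ * dSq 3 (φ s) + (dSq 3 (ψ s) + dSq 1 (dt ψ s))
        + (ε ^ 2)⁻¹ * (dSq 3 (θ s) + dSq 1 (dt θ s))))
    + ∫ s in (0 : ℝ)..t, (L2Sq (dt (dt ψ) s) + (ε ^ 2)⁻¹ * L2Sq (dt (dt θ) s))

/-- The total weighted energy functional `N(t)`. -/
def Nfun (ε : ℝ) (φ : ℝ → ℝ × ℝ → ℝ) (ψ : ℝ → ℝ × ℝ → ℝ × ℝ) (θ : ℝ → ℝ × ℝ → ℝ)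
    (t : ℝ) : ℝ :=
  (ε ^ 2)⁻¹ * A0 ε φ ψ θ t + A1 ε φ ψ θ t + A2 ε φ ψ θ t
    + ε ^ 2 * A3 ε φ ψ θ t + ε ^ 2 * A4 ε φ ψ θ t + ε ^ 4 * A5 ε φ ψ θ t

/-- The relative entropy
`η = (ε²ρ/𝒯̃)|ψ|² + (ρ/(γ-1))(𝒯/𝒯̃ - ln(𝒯/𝒯̃) - 1) + ρ(τ/τ̃ - ln(τ/τ̃) - 1)`,
where `τ = 1/ρ`, `τ̃ = 1/ρ̃`. -/
def relEnt (γ Pr ε χ : ℝ) (φ θ : ℝ → ℝ × ℝ → ℝ) (ψ : ℝ → ℝ × ℝ → ℝ × ℝ)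
    (t : ℝ) (x : ℝ × ℝ) : ℝ :=
  ε ^ 2 * pρ γ Pr ε χ φ t x / tT γ Pr ε χ x * ‖ψ t x‖ ^ 2
    + pρ γ Pr ε χ φ t x / (γ - 1) *
        (pT γ Pr ε χ θ t x / tT γ Pr ε χ x
          - Real.log (pT γ Pr ε χ θ t x / tT γ Pr ε χ x) - 1)
    + pρ γ Pr ε χ φ t x *
        ((pρ γ Pr ε χ φ t x)⁻¹ / (tρ γ Pr ε χ x)⁻¹
          - Real.log ((pρ γ Pr ε χ φ t x)⁻¹ / (tρ γ Pr ε χ x)⁻¹) - 1)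

/-- A classical solution `(ρ, u, 𝒯)` of the non-dimensional full compressible
Navier–Stokes system on `Ω × (0,∞)`, with non-slip and isothermal boundary
conditions and periodicity in `x₁`. -/
structure FullSol (γ Pr r Re ε χ : ℝ) where
  rho : ℝ → ℝ × ℝ → ℝ
  vel : ℝ → ℝ × ℝ → ℝ × ℝ
  temp : ℝ → ℝ × ℝ → ℝ
  mass_eq : ∀ t ∈ Set.Ioi (0 : ℝ), ∀ x ∈ Ω,
    dt rho t x + divv (fun y => rho t y • vel t y) x = 0
  mom_eq1 : ∀ t ∈ Set.Ioi (0 : ℝ), ∀ x ∈ Ω,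
    rho t x * ((dt vel t x).1 + dot (vel t x) (grad (fun y => (vel t y).1) x))
      + (ε ^ 2)⁻¹ * d1 (fun y => rho t y * temp t y) x
      = Re⁻¹ * lap (fun y => (vel t y).1) x + (Re⁻¹ + r * Re⁻¹) * d1 (divv (vel t)) x
  mom_eq2 : ∀ t ∈ Set.Ioi (0 : ℝ), ∀ x ∈ Ω,
    rho t x * ((dt vel t x).2 + dot (vel t x) (grad (fun y => (vel t y).2) x))
      + (ε ^ 2)⁻¹ * d2 (fun y => rho t y * temp t y) x
      = Re⁻¹ * lap (fun y => (vel t y).2) x + (Re⁻¹ + r * Re⁻¹) * d2 (divv (vel t)) x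
  energy_eq : ∀ t ∈ Set.Ioi (0 : ℝ), ∀ x ∈ Ω,
    rho t x / (γ - 1) * (dt temp t x + dot (vel t x) (grad (temp t) x))
      + rho t x * temp t x * divv (vel t) x
      = γ / (γ - 1) / (Re * Pr) * lap (temp t) x
        + ε ^ 2 * (2 * Re⁻¹ * defContract (vel t) (vel t) x
            + r * Re⁻¹ * (divv (vel t) x) ^ 2)
  bc_top : ∀ t ∈ Set.Ioi (0 : ℝ), ∀ x : ℝ × ℝ, x.2 = 1 →
    vel t x = (1, 0) ∧ temp t x = 1
  bc_bot : ∀ t ∈ Set.Ioi (0 : ℝ), ∀ x : ℝ × ℝ, x.2 = 0 →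
    vel t x = 0 ∧ temp t x = χ
  periodic_rho : ∀ t x, rho t (x.1 + 2 * π, x.2) = rho t x
  periodic_vel : ∀ t x, vel t (x.1 + 2 * π, x.2) = vel t x
  periodic_temp : ∀ t x, temp t (x.1 + 2 * π, x.2) = temp t x

/-- `∂tφ(0)`, defined from the initial data by taking `t = 0` in the mass equation
of the perturbation system. -/
def dtφ0 (γ Pr ε χ : ℝ) (φ₀ : ℝ × ℝ → ℝ) (ψ₀ : ℝ × ℝ → ℝ × ℝ) (x : ℝ × ℝ) : ℝ :=
  -(dot (tu x + ψ₀ x) (grad φ₀ x) + (tρ γ Pr ε χ x + φ₀ x) * divv ψ₀ x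
      + dot (ψ₀ x) (grad (tρ γ Pr ε χ) x))

/-- `∂tψ(0)`, defined from the initial data by taking `t = 0` in the momentum
equation of the perturbation system. -/
def dtψ0 (γ Pr r Re ε χ : ℝ) (φ₀ θ₀ : ℝ × ℝ → ℝ) (ψ₀ : ℝ × ℝ → ℝ × ℝ)
    (x : ℝ × ℝ) : ℝ × ℝ :=
  ((tρ γ Pr ε χ x + φ₀ x)⁻¹ *
      (Re⁻¹ * lap (fun y => (ψ₀ y).1) x + (Re⁻¹ + r * Re⁻¹) * d1 (divv ψ₀) x
        - (ε ^ 2)⁻¹ * d1 (fun y => (tρ γ Pr ε χ y + φ₀ y) * (tT γ Pr ε χ y + θ₀ y)) x)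
      - dot (tu x + ψ₀ x) (grad (fun y => (ψ₀ y).1) x)
      - dot (ψ₀ x) (grad (fun y => (tu y).1) x),
   (tρ γ Pr ε χ x + φ₀ x)⁻¹ *
      (Re⁻¹ * lap (fun y => (ψ₀ y).2) x + (Re⁻¹ + r * Re⁻¹) * d2 (divv ψ₀) x
        - (ε ^ 2)⁻¹ * d2 (fun y => (tρ γ Pr ε χ y + φ₀ y) * (tT γ Pr ε χ y + θ₀ y)) x)
      - dot (tu x + ψ₀ x) (grad (fun y => (ψ₀ y).2) x)
      - dot (ψ₀ x) (grad (fun y => (tu y).2) x))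

/-- `∂tθ(0)`, defined from the initial data by taking `t = 0` in the temperature
equation of the perturbation system. -/
def dtθ0 (γ Pr r Re ε χ : ℝ) (φ₀ θ₀ : ℝ × ℝ → ℝ) (ψ₀ : ℝ × ℝ → ℝ × ℝ)
    (x : ℝ × ℝ) : ℝ :=
  (γ - 1) * (tρ γ Pr ε χ x + φ₀ x)⁻¹ *
      (γ / (γ - 1) / (Re * Pr) * lap θ₀ x
        - (tρ γ Pr ε χ x + φ₀ x) * (tT γ Pr ε χ x + θ₀ x) * divv ψ₀ x
        + ε ^ 2 * (2 * Re⁻¹ * defContract ψ₀ ψ₀ x + 4 * Re⁻¹ * defContract tu ψ₀ x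
            + r * Re⁻¹ * (divv ψ₀ x) ^ 2))
    - dot (tu x + ψ₀ x) (grad θ₀ x) - dot (ψ₀ x) (grad (tT γ Pr ε χ) x)


section Helpers

lemma cs_interval (u : ℝ → ℝ) (hu : Continuous u) (a h : ℝ) (hh : 0 < h) :
    (∫ y in a..(a + h), u y) ^ 2 ≤ h * ∫ y in a..(a + h), u y ^ 2 := by
  set I := ∫ y in a..(a + h), u y with hI
  set J := ∫ y in a..(a + h), u y ^ 2 with hJ
  have h1 : 0 ≤ ∫ y in a..(a + h), (u y ^ 2 - 2 * (I / h) * u y + (I / h) ^ 2) := by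
    apply intervalIntegral.integral_nonneg (by linarith)
    intro y _
    nlinarith [sq_nonneg (u y - I / h)]
  have i1 : IntervalIntegrable (fun y => u y ^ 2) volume a (a + h) :=
    (by fun_prop : Continuous fun y => u y ^ 2).intervalIntegrable _ _
  have i2 : IntervalIntegrable (fun y => 2 * (I / h) * u y) volume a (a + h) :=
    (by fun_prop : Continuous fun y => 2 * (I / h) * u y).intervalIntegrable _ _
  have i3 : IntervalIntegrable (fun _ : ℝ => (I / h) ^ 2) volume a (a + h) :=
    continuous_const.intervalIntegrable _ _
  rw [intervalIntegral.integral_add (i1.sub i2) i3, intervalIntegral.integral_sub i1 i2,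
    intervalIntegral.integral_const_mul, intervalIntegral.integral_const] at h1
  rw [← hI, ← hJ] at h1
  simp only [add_sub_cancel_left, smul_eq_mul] at h1
  have h2 : J - 2 * (I / h) * I + h * (I / h) ^ 2 = J - I ^ 2 / h := by
    field_simp
    ring
  rw [h2] at h1
  have h3 : I ^ 2 / h ≤ J := by linarith
  rw [div_le_iff₀ hh] at h3
  linarith

variable {E : Type*} [NormedAddCommGroup E] [NormedSpace ℝ E] [CompleteSpace E]

lemma sob1 (g g' : ℝ → E) (hg : ∀ y, HasDerivAt g (g' y) y) (hg' : Continuous g')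
    (a h x : ℝ) (hh : 0 < h) (hx : x ∈ Set.Icc a (a + h)) :
    ‖g x‖ ^ 2 ≤ 2 / h * (∫ y in a..(a + h), ‖g y‖ ^ 2)
      + 2 * h * ∫ y in a..(a + h), ‖g' y‖ ^ 2 := by
  have hgc : Continuous g := continuous_iff_continuousAt.2 fun y => (hg y).continuousAt
  set K := ∫ y in a..(a + h), ‖g' y‖ ^ 2 with hK
  have key : ∀ y ∈ Set.Icc a (a + h), ‖g x‖ ^ 2 ≤ 2 * ‖g y‖ ^ 2 + 2 * (h * K) := by
    intro y hy
    have e1 : ∫ s in y..x, g' s = g x - g y :=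
      intervalIntegral.integral_eq_sub_of_hasDerivAt (fun s _ => hg s)
        (hg'.intervalIntegrable _ _)
    have e2 : ‖∫ s in y..x, g' s‖ ≤ ∫ s in a..(a + h), ‖g' s‖ := by
      refine (intervalIntegral.norm_integral_le_integral_norm_uIoc).trans ?_
      rw [intervalIntegral.integral_of_le (by linarith : a ≤ a + h)]
      apply setIntegral_mono_set
      · exact (hg'.norm.integrableOn_Icc).mono_set Set.Ioc_subset_Icc_self
      · exact Eventually.of_forall fun s => norm_nonneg _
      · apply HasSubset.Subset.eventuallyLE
        intro s hs
        rcases Set.mem_uIoc.1 hs with hs | hs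
        · exact ⟨lt_of_le_of_lt hy.1 hs.1, hs.2.trans hx.2⟩
        · exact ⟨lt_of_le_of_lt hx.1 hs.1, hs.2.trans hy.2⟩
    have e3 := cs_interval (fun s => ‖g' s‖) hg'.norm a h hh
    rw [← hK] at e3
    have e4 : ‖g x‖ ≤ ‖g y‖ + ∫ s in a..(a + h), ‖g' s‖ := by
      have : g x = g y + (g x - g y) := by abel
      rw [e1] at e2
      calc ‖g x‖ = ‖g y + (g x - g y)‖ := by rw [← this]
        _ ≤ _ := (norm_add_le _ _).trans (by linarith)
    nlinarith [norm_nonneg (g x), norm_nonneg (g y),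
      sq_nonneg (‖g y‖ - ∫ s in a..(a + h), ‖g' s‖)]
  have h1 : ∫ _y in a..(a + h), ‖g x‖ ^ 2 ≤ ∫ y in a..(a + h), (2 * ‖g y‖ ^ 2 + 2 * (h * K)) := by
    apply intervalIntegral.integral_mono_on (by linarith) (continuous_const.intervalIntegrable _ _)
    · exact (by fun_prop : Continuous fun y => 2 * ‖g y‖ ^ 2 + 2 * (h * K)).intervalIntegrable _ _
    · exact key
  have i1 : IntervalIntegrable (fun y => 2 * ‖g y‖ ^ 2) volume a (a + h) :=
    (by fun_prop : Continuous fun y => 2 * ‖g y‖ ^ 2).intervalIntegrable _ _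
  rw [intervalIntegral.integral_add i1 (continuous_const.intervalIntegrable _ _),
    intervalIntegral.integral_const_mul, intervalIntegral.integral_const,
    intervalIntegral.integral_const] at h1
  simp only [add_sub_cancel_left, smul_eq_mul] at h1
  have h2 : 2 / h * (∫ y in a..(a + h), ‖g y‖ ^ 2) + 2 * h * K
      = (2 * (∫ y in a..(a + h), ‖g y‖ ^ 2) + h * (2 * (h * K))) / h := by
    field_simp
  rw [h2, le_div_iff₀ hh]
  linarith

lemma hasDerivAt_d1 (f : ℝ × ℝ → E) (hf : Differentiable ℝ f) (s y : ℝ) :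
    HasDerivAt (fun s => f (s, y)) (d1 f (s, y)) s := by
  have h := (hf (s, y)).hasFDerivAt
  have h2 : HasDerivAt (fun s : ℝ => (s, y)) ((1 : ℝ), (0 : ℝ)) s :=
    (hasDerivAt_id s).prodMk (hasDerivAt_const s y)
  exact h.comp_hasDerivAt s h2

lemma hasDerivAt_d2 (f : ℝ × ℝ → E) (hf : Differentiable ℝ f) (s y : ℝ) :
    HasDerivAt (fun y => f (s, y)) (d2 f (s, y)) y := by
  have h := (hf (s, y)).hasFDerivAt
  have h2 : HasDerivAt (fun y : ℝ => (s, y)) ((0 : ℝ), (1 : ℝ)) y :=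
    (hasDerivAt_const y s).prodMk (hasDerivAt_id y)
  exact h.comp_hasDerivAt y h2

lemma contDiff_d1 {n m : ℕ} (f : ℝ × ℝ → E) (hf : ContDiff ℝ n f) (h : m + 1 ≤ n) :
    ContDiff ℝ m (d1 f) :=
  (hf.fderiv_right (m := m) (by exact_mod_cast h)).clm_apply contDiff_const

lemma contDiff_d2 {n m : ℕ} (f : ℝ × ℝ → E) (hf : ContDiff ℝ n f) (h : m + 1 ≤ n) :
    ContDiff ℝ m (d2 f) :=
  (hf.fderiv_right (m := m) (by exact_mod_cast h)).clm_apply contDiff_const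

lemma Ω_eq : Ω = Set.Ioo 0 (2 * π) ×ˢ Set.Ioo 0 1 := rfl

lemma integrableOn_Ω (u : ℝ × ℝ → ℝ) (hu : Continuous u) : IntegrableOn u Ω := by
  have : IntegrableOn u (Set.Icc 0 (2 * π) ×ˢ Set.Icc 0 1) :=
    hu.continuousOn.integrableOn_compact (isCompact_Icc.prod isCompact_Icc)
  exact this.mono_set (Set.prod_mono Set.Ioo_subset_Icc_self Set.Ioo_subset_Icc_self)

lemma iter_le_Ω (u : ℝ × ℝ → ℝ) (hu : Continuous u) (hp : ∀ x, 0 ≤ u x) (a b h : ℝ)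
    (hh : 0 < h) (ha : 0 < a) (ha' : a + h < 2 * π) (hb : 0 < b) (hb' : b + h < 1) :
    (∫ s in a..(a + h), ∫ y in b..(b + h), u (s, y)) ≤ ∫ x in Ω, u x := by
  have hsub : Set.Ioc a (a + h) ×ˢ Set.Ioc b (b + h) ⊆ Ω := by
    rintro ⟨s, y⟩ ⟨⟨h1, h2⟩, ⟨h3, h4⟩⟩
    exact ⟨⟨ha.trans h1, h2.trans_lt ha'⟩, ⟨hb.trans h3, h4.trans_lt hb'⟩⟩
  have hi := integrableOn_Ω u hu
  have e : (∫ s in a..(a + h), ∫ y in b..(b + h), u (s, y))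
      = ∫ x in Set.Ioc a (a + h) ×ˢ Set.Ioc b (b + h), u x := by
    rw [Measure.volume_eq_prod, setIntegral_prod]
    · rw [intervalIntegral.integral_of_le (by linarith)]
      simp_rw [intervalIntegral.integral_of_le (by linarith : b ≤ b + h)]
    · exact hi.mono_set hsub
  rw [e]
  exact setIntegral_mono_set hi (Eventually.of_forall hp) hsub.eventuallyLE

lemma sob_rect (f : ℝ × ℝ → E) (hf : ContDiff ℝ 2 f) (a b h : ℝ) (x : ℝ × ℝ)
    (hh : 0 < h) (ha : 0 < a) (ha' : a + h < 2 * π) (hb : 0 < b) (hb' : b + h < 1)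
    (hx1 : x.1 ∈ Set.Icc a (a + h)) (hx2 : x.2 ∈ Set.Icc b (b + h)) :
    ‖f x‖ ^ 2 ≤ 2 / h * (2 / h * (∫ y in Ω, ‖f y‖ ^ 2) + 2 * h * ∫ y in Ω, ‖d2 f y‖ ^ 2)
      + 2 * h * (2 / h * (∫ y in Ω, ‖d1 f y‖ ^ 2) + 2 * h * ∫ y in Ω, ‖d2 (d1 f) y‖ ^ 2) := by
  have hf1 : ContDiff ℝ 1 (d1 f) := by exact_mod_cast contDiff_d1 (n := 2) (m := 1) f hf le_rfl
  have hf2 : ContDiff ℝ 1 (d2 f) := by exact_mod_cast contDiff_d2 (n := 2) (m := 1) f hf le_rfl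
  have hf12 : Continuous (d2 (d1 f)) :=
    (contDiff_d2 (n := 1) (m := 0) (d1 f) (by exact_mod_cast hf1) le_rfl).continuous
  have step : ∀ (g : ℝ × ℝ → E), ContDiff ℝ 1 g →
      (∫ s in a..(a + h), ‖g (s, x.2)‖ ^ 2) ≤
        2 / h * (∫ y in Ω, ‖g y‖ ^ 2) + 2 * h * ∫ y in Ω, ‖d2 g y‖ ^ 2 := by
    intro g hg
    have hgd : Differentiable ℝ g := hg.differentiable (by norm_num)
    have hg2 : Continuous (d2 g) :=
      (contDiff_d2 (n := 1) (m := 0) g (by exact_mod_cast hg) le_rfl).continuous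
    have hgc := hg.continuous
    have c1 : Continuous fun s => ∫ y in b..(b + h), ‖g (s, y)‖ ^ 2 :=
      intervalIntegral.continuous_parametric_intervalIntegral_of_continuous'
        (f := fun s y => ‖g (s, y)‖ ^ 2)
        (by simp only [Function.uncurry_def]; fun_prop) _ _
    have c2 : Continuous fun s => ∫ y in b..(b + h), ‖d2 g (s, y)‖ ^ 2 :=
      intervalIntegral.continuous_parametric_intervalIntegral_of_continuous'
        (f := fun s y => ‖d2 g (s, y)‖ ^ 2)
        (by simp only [Function.uncurry_def]; fun_prop) _ _
    have h1 : (∫ s in a..(a + h), ‖g (s, x.2)‖ ^ 2) ≤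
        ∫ s in a..(a + h), (2 / h * (∫ y in b..(b + h), ‖g (s, y)‖ ^ 2)
          + 2 * h * ∫ y in b..(b + h), ‖d2 g (s, y)‖ ^ 2) := by
      apply intervalIntegral.integral_mono_on (by linarith)
      · exact (by fun_prop : Continuous fun s => ‖g (s, x.2)‖ ^ 2).intervalIntegrable _ _
      · exact ((c1.const_mul _).add (c2.const_mul _)).intervalIntegrable _ _
      · intro s _
        exact sob1 (fun y => g (s, y)) (fun y => d2 g (s, y)) (fun y => hasDerivAt_d2 g hgd s y)
          (by fun_prop) b h x.2 hh hx2
    rw [intervalIntegral.integral_add ((c1.const_mul _).intervalIntegrable _ _)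
      ((c2.const_mul _).intervalIntegrable _ _), intervalIntegral.integral_const_mul,
      intervalIntegral.integral_const_mul] at h1
    have h2 := iter_le_Ω (fun y => ‖g y‖ ^ 2) (by fun_prop) (fun y => by positivity) a b h hh
      ha ha' hb hb'
    have h3 := iter_le_Ω (fun y => ‖d2 g y‖ ^ 2) (by fun_prop) (fun y => by positivity) a b h hh
      ha ha' hb hb'
    refine h1.trans ?_
    gcongr
  have hfd : Differentiable ℝ f := hf.differentiable (by norm_num)
  have hd1c := hf1.continuous
  have h0 := sob1 (fun s => f (s, x.2)) (fun s => d1 f (s, x.2))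
    (fun s => hasDerivAt_d1 f hfd s x.2) (by fun_prop) a h x.1 hh hx1
  have h1 := step f (hf.of_le (by norm_num))
  have h2 := step (d1 f) hf1
  refine h0.trans ?_
  gcongr

lemma norm_d_le1 (f : ℝ × ℝ → E) (x : ℝ × ℝ) :
    ‖d1 f x‖ ≤ ‖iteratedFDeriv ℝ 1 f x‖ ∧ ‖d2 f x‖ ≤ ‖iteratedFDeriv ℝ 1 f x‖ := by
  have e : ‖iteratedFDeriv ℝ 1 f x‖ = ‖fderiv ℝ f x‖ := norm_iteratedFDeriv_one f
  rw [e]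
  constructor
  · have := (fderiv ℝ f x).le_opNorm (1, 0)
    simpa [d1, Prod.norm_def] using this
  · have := (fderiv ℝ f x).le_opNorm (0, 1)
    simpa [d2, Prod.norm_def] using this

lemma norm_d_le2 (f : ℝ × ℝ → E) (hf : ContDiff ℝ 2 f) (x : ℝ × ℝ) :
    ‖d2 (d1 f) x‖ ≤ ‖iteratedFDeriv ℝ 2 f x‖ := by
  have hd : DifferentiableAt ℝ (fderiv ℝ f) x :=
    ((hf.fderiv_right (m := 1) (by norm_num)).differentiable (by norm_num)) x
  have e : d2 (d1 f) x = fderiv ℝ (fderiv ℝ f) x (0, 1) (1, 0) := by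
    unfold d2 d1
    rw [fderiv_clm_apply hd (differentiableAt_const _)]
    simp
  have e2 : ‖iteratedFDeriv ℝ 2 f x‖ = ‖fderiv ℝ (fderiv ℝ f) x‖ := by
    rw [← norm_iteratedFDeriv_fderiv, norm_iteratedFDeriv_one]
  rw [e, e2]
  have h1 := (fderiv ℝ (fderiv ℝ f) x).le_opNorm₂ (0, 1) (1, 0)
  simpa [Prod.norm_def] using h1

/-- Scaled Sobolev embedding `H² ⊂ L∞` in two dimensions. -/
lemma sob_Ω (f : ℝ × ℝ → E) (hf : ContDiff ℝ 2 f) (h : ℝ) (x : ℝ × ℝ) (hx : x ∈ Ω)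
    (hh : 0 < h) (hh1 : h < 1) :
    ‖f x‖ ^ 2 ≤ 4 * (h ^ 2)⁻¹ * dSq 0 f + 8 * dSq 1 f + 4 * h ^ 2 * dSq 2 f := by
  obtain ⟨⟨hx1, hx2⟩, ⟨hx3, hx4⟩⟩ := hx
  have hpi := Real.pi_gt_three
  have hq : 0 < h / (2 * π) := by positivity
  have hq1 : h / (2 * π) < 1 := by rw [div_lt_one (by positivity)]; linarith
  have hq2 : h / (2 * π) * (2 * π) = h := by field_simp
  set q := h / (2 * π) with hqd
  have main := sob_rect f hf (x.1 * (1 - q)) (x.2 * (1 - h)) h x hh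
    (by apply mul_pos hx1; linarith)
    (by nlinarith)
    (by apply mul_pos hx3; linarith) (by nlinarith)
    ⟨by nlinarith, by nlinarith⟩ ⟨by nlinarith, by nlinarith⟩
  have hd1c : Continuous (d1 f) :=
    (contDiff_d1 (n := 2) (m := 1) f (by exact_mod_cast hf) le_rfl).continuous
  have hd2c : Continuous (d2 f) :=
    (contDiff_d2 (n := 2) (m := 1) f (by exact_mod_cast hf) le_rfl).continuous
  have hf12 : Continuous (d2 (d1 f)) :=
    (contDiff_d2 (n := 1) (m := 0) (d1 f)
      (contDiff_d1 (n := 2) (m := 1) f (by exact_mod_cast hf) le_rfl) le_rfl).continuous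
  have ci1 : Continuous (iteratedFDeriv ℝ 1 f) := hf.continuous_iteratedFDeriv (by norm_num)
  have ci2 : Continuous (iteratedFDeriv ℝ 2 f) := hf.continuous_iteratedFDeriv (by norm_num)
  have i0 : (∫ y in Ω, ‖f y‖ ^ 2) = dSq 0 f := by simp [dSq]
  have i1 : (∫ y in Ω, ‖d1 f y‖ ^ 2) ≤ dSq 1 f := by
    apply setIntegral_mono (integrableOn_Ω _ (by fun_prop)) (integrableOn_Ω _ (by fun_prop))
    intro y
    have := (norm_d_le1 f y).1
    dsimp only
    gcongr
  have i2 : (∫ y in Ω, ‖d2 f y‖ ^ 2) ≤ dSq 1 f := by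
    apply setIntegral_mono (integrableOn_Ω _ (by fun_prop)) (integrableOn_Ω _ (by fun_prop))
    intro y
    have := (norm_d_le1 f y).2
    dsimp only
    gcongr
  have i3 : (∫ y in Ω, ‖d2 (d1 f) y‖ ^ 2) ≤ dSq 2 f := by
    apply setIntegral_mono (integrableOn_Ω _ (by fun_prop)) (integrableOn_Ω _ (by fun_prop))
    intro y
    have := norm_d_le2 f hf y
    dsimp only
    gcongr
  rw [i0] at main
  calc ‖f x‖ ^ 2 ≤ _ := main
    _ ≤ 2 / h * (2 / h * dSq 0 f + 2 * h * dSq 1 f)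
      + 2 * h * (2 / h * dSq 1 f + 2 * h * dSq 2 f) := by gcongr
    _ = _ := by field_simp; ring

lemma dSq_nonneg (j : ℕ) (f : ℝ × ℝ → E) : 0 ≤ dSq j f :=
  integral_nonneg fun _ => by positivity

lemma L2Sq_nonneg (f : ℝ × ℝ → E) : 0 ≤ L2Sq f := dSq_nonneg 0 f

lemma HSq_nonneg (k : ℕ) (f : ℝ × ℝ → E) : 0 ≤ HSq k f :=
  Finset.sum_nonneg fun j _ => dSq_nonneg j f

lemma volΩ : (volume : Measure (ℝ × ℝ)).real Ω = 2 * π := by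
  rw [Ω_eq, Measure.volume_eq_prod, measureReal_prod_prod]
  simp [Real.volume_real_Ioo_of_le (by positivity : (0 : ℝ) ≤ 2 * π)]

lemma volΩ_lt : (volume : Measure (ℝ × ℝ)) Ω < ⊤ := by
  rw [Ω_eq, Measure.volume_eq_prod, Measure.prod_prod]
  simp [ENNReal.mul_lt_top_iff]

lemma dSq_le_of_bound (j : ℕ) (f : ℝ × ℝ → E) (B : ℝ)
    (hB : ∀ x ∈ Ω, ‖iteratedFDeriv ℝ j f x‖ ≤ B) : dSq j f ≤ B ^ 2 * (2 * π) := by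
  have h := norm_setIntegral_le_of_norm_le_const (μ := volume) (s := Ω)
    (f := fun x => ‖iteratedFDeriv ℝ j f x‖ ^ 2) (C := B ^ 2) volΩ_lt (by
      intro x hx
      rw [Real.norm_of_nonneg (by positivity)]
      have := hB x hx
      gcongr)
  rw [volΩ] at h
  exact (le_abs_self _).trans h

lemma slice_bound (j : ℕ) (f : ℝ → ℝ × ℝ → E) (hf : ContDiff ℝ (⊤ : ℕ∞) (Function.uncurry f))
    (T : ℝ) : ∃ B, ∀ s ∈ Set.Icc (0 : ℝ) T, dSq j (f s) ≤ B := by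
  set K : Set (ℝ × (ℝ × ℝ)) := Set.Icc 0 T ×ˢ (Set.Icc 0 (2 * π) ×ˢ Set.Icc 0 1)
  have hK : IsCompact K := isCompact_Icc.prod (isCompact_Icc.prod isCompact_Icc)
  have hc : Continuous (iteratedFDeriv ℝ j (Function.uncurry f)) :=
    hf.continuous_iteratedFDeriv (by exact_mod_cast le_top)
  obtain ⟨B, hB⟩ := hK.exists_bound_of_continuousOn hc.continuousOn
  set L := ContinuousLinearMap.inr ℝ ℝ (ℝ × ℝ) with hL
  refine ⟨(B * ‖L‖ ^ j) ^ 2 * (2 * π), fun s hs => dSq_le_of_bound j _ _ fun x hx => ?_⟩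
  have e : f s = (fun p : ℝ × (ℝ × ℝ) => Function.uncurry f (p + (s, 0))) ∘ L := by
    funext y
    simp [hL, Function.uncurry]
  have hsm : ContDiff ℝ (⊤ : ℕ∞) (fun p : ℝ × (ℝ × ℝ) => Function.uncurry f (p + (s, 0))) :=
    hf.comp (contDiff_id.add contDiff_const)
  rw [e, L.iteratedFDeriv_comp_right hsm x (by exact_mod_cast le_top),
    iteratedFDeriv_comp_add_right]
  refine (ContinuousMultilinearMap.norm_compContinuousLinearMap_le _ _).trans ?_
  rw [Finset.prod_const, Finset.card_univ, Fintype.card_fin]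
  have e2 : L x + (s, 0) = (s, x) := by simp [hL]
  rw [e2]
  have := hB (s, x) ⟨hs, ⟨Set.Ioo_subset_Icc_self hx.1, Set.Ioo_subset_Icc_self hx.2⟩⟩
  gcongr

lemma smooth_slice (f : ℝ → ℝ × ℝ → E) (hf : ContDiff ℝ (⊤ : ℕ∞) (Function.uncurry f)) (t : ℝ) :
    ContDiff ℝ (⊤ : ℕ∞) (f t) := by
  have : f t = Function.uncurry f ∘ fun x => (t, x) := rfl
  rw [this]
  exact hf.comp (contDiff_const.prodMk contDiff_id)

lemma smooth_dt (f : ℝ → ℝ × ℝ → E) (hf : ContDiff ℝ (⊤ : ℕ∞) (Function.uncurry f)) :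
    ContDiff ℝ (⊤ : ℕ∞) (Function.uncurry (dt f)) := by
  have e : Function.uncurry (dt f) = fun p => fderiv ℝ (Function.uncurry f) p (1, 0) := by
    funext ⟨t, x⟩
    have hd : Differentiable ℝ (Function.uncurry f) := hf.differentiable (by simp)
    have h := (hd (t, x)).hasFDerivAt
    have h2 : HasDerivAt (fun s : ℝ => (s, x)) ((1 : ℝ), (0 : ℝ × ℝ)) t :=
      (hasDerivAt_id t).prodMk (hasDerivAt_const t x)
    exact (h.comp_hasDerivAt t h2).deriv
  rw [e]
  exact (hf.fderiv_right (m := (⊤ : ℕ∞)) (by simp)).clm_apply contDiff_const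

lemma le_sup (G : ℝ → ℝ) (T B : ℝ) (hG : ∀ s ∈ Set.Icc (0 : ℝ) T, G s ≤ B) (t : ℝ)
    (ht : t ∈ Set.Icc (0 : ℝ) T) : G t ≤ ⨆ s ∈ Set.Icc (0 : ℝ) T, G s := by
  have hb : BddAbove (Set.range fun s => ⨆ (_ : s ∈ Set.Icc (0 : ℝ) T), G s) := by
    refine ⟨max B 0, ?_⟩
    rintro _ ⟨s, rfl⟩
    dsimp only
    by_cases hs : s ∈ Set.Icc (0 : ℝ) T
    · rw [ciSup_pos hs]
      exact (hG s hs).trans (le_max_left _ _)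
    · haveI : IsEmpty (s ∈ Set.Icc (0 : ℝ) T) := ⟨hs⟩
      rw [Real.iSup_of_isEmpty]
      exact le_max_right _ _
  refine le_trans (le_of_eq ?_) (le_ciSup hb t)
  rw [ciSup_pos ht]

lemma sup_le (G : ℝ × ℝ → ℝ) (B : ℝ) (hB : 0 ≤ B) (hG : ∀ s ∈ Ω, G s ≤ B) :
    (⨆ s ∈ Ω, G s) ≤ B :=
  Real.iSup_le (fun s => Real.iSup_le (fun hs => hG s hs) hB) hB

lemma energy_lower (ε T : ℝ) (hε : 0 < ε) (hT : 0 ≤ T) (φ : ℝ → ℝ × ℝ → ℝ)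
    (ψ : ℝ → ℝ × ℝ → ℝ × ℝ) (θ : ℝ → ℝ × ℝ → ℝ)
    (hφ : ContDiff ℝ (⊤ : ℕ∞) (Function.uncurry φ))
    (hψ : ContDiff ℝ (⊤ : ℕ∞) (Function.uncurry ψ))
    (hθ : ContDiff ℝ (⊤ : ℕ∞) (Function.uncurry θ)) (t : ℝ) (ht : t ∈ Set.Icc (0 : ℝ) T) :
    (ε ^ 2)⁻¹ * (dSq 0 (ψ t) + (ε ^ 2)⁻¹ * dSq 0 (φ t) + (ε ^ 2)⁻¹ * dSq 0 (θ t))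
      + (dSq 1 (ψ t) + (ε ^ 2)⁻¹ * dSq 1 (θ t)) + (ε ^ 2)⁻¹ * dSq 1 (φ t)
      + ε ^ 2 * ((ε ^ 2)⁻¹ * dSq 2 (φ t) + dSq 2 (ψ t) + (ε ^ 2)⁻¹ * dSq 2 (θ t))
      + ε ^ 4 * ((ε ^ 2)⁻¹ * dSq 3 (φ t) + dSq 3 (ψ t) + (ε ^ 2)⁻¹ * dSq 3 (θ t))
      ≤ Nfun ε φ ψ θ T := by
  have hi : 0 ≤ (ε ^ 2)⁻¹ := by positivity
  have a0 : dSq 0 (ψ t) + (ε ^ 2)⁻¹ * dSq 0 (φ t) + (ε ^ 2)⁻¹ * dSq 0 (θ t) ≤ A0 ε φ ψ θ T := by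
    obtain ⟨B1, h1⟩ := slice_bound 0 ψ hψ T
    obtain ⟨B2, h2⟩ := slice_bound 0 φ hφ T
    obtain ⟨B3, h3⟩ := slice_bound 0 θ hθ T
    have h := le_sup (fun s => L2Sq (ψ s) + (ε ^ 2)⁻¹ * L2Sq (φ s) + (ε ^ 2)⁻¹ * L2Sq (θ s)) T
      (B1 + (ε ^ 2)⁻¹ * B2 + (ε ^ 2)⁻¹ * B3) (fun s hs => by
        have := h1 s hs
        have := h2 s hs
        have := h3 s hs
        simp only [L2Sq]
        gcongr) t ht
    have h' : 0 ≤ ∫ s in (0 : ℝ)..T, (HSq 1 (ψ s) + (ε ^ 2)⁻¹ * HSq 1 (θ s)) :=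
      intervalIntegral.integral_nonneg hT fun s _ =>
        add_nonneg (HSq_nonneg _ _) (mul_nonneg hi (HSq_nonneg _ _))
    unfold A0
    simp only [L2Sq] at h ⊢
    linarith
  have a1 : dSq 1 (ψ t) + (ε ^ 2)⁻¹ * dSq 1 (θ t) ≤ A1 ε φ ψ θ T := by
    obtain ⟨B1, h1⟩ := slice_bound 1 ψ hψ T
    obtain ⟨B3, h3⟩ := slice_bound 1 θ hθ T
    have h := le_sup (fun s => dSq 1 (ψ s) + (ε ^ 2)⁻¹ * dSq 1 (θ s)) T
      (B1 + (ε ^ 2)⁻¹ * B3) (fun s hs => by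
        have := h1 s hs
        have := h3 s hs
        gcongr) t ht
    have h' : 0 ≤ ∫ s in (0 : ℝ)..T, (L2Sq (dt ψ s) + (ε ^ 2)⁻¹ * L2Sq (dt θ s)) :=
      intervalIntegral.integral_nonneg hT fun s _ =>
        add_nonneg (L2Sq_nonneg _) (mul_nonneg hi (L2Sq_nonneg _))
    unfold A1
    linarith
  have a2 : (ε ^ 2)⁻¹ * dSq 1 (φ t) ≤ A2 ε φ ψ θ T := by
    obtain ⟨B1, h1⟩ := slice_bound 1 φ hφ T
    have h := le_sup (fun s => dSq 1 (φ s)) T B1 h1 t ht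
    have h2 := mul_le_mul_of_nonneg_left h hi
    have h' : 0 ≤ ∫ s in (0 : ℝ)..T, ((ε ^ 4)⁻¹ * HSq 1 (φ s) + (ε ^ 2)⁻¹ * L2Sq (dt φ s)) :=
      intervalIntegral.integral_nonneg hT fun s _ =>
        add_nonneg (mul_nonneg (by positivity) (HSq_nonneg _ _)) (mul_nonneg hi (L2Sq_nonneg _))
    have h'' : 0 ≤ ∫ s in (0 : ℝ)..T, (HSq 2 (ψ s) + (ε ^ 2)⁻¹ * HSq 2 (θ s)) :=
      intervalIntegral.integral_nonneg hT fun s _ =>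
        add_nonneg (HSq_nonneg _ _) (mul_nonneg hi (HSq_nonneg _ _))
    unfold A2
    linarith
  have a3 : 0 ≤ A3 ε φ ψ θ T := by
    unfold A3
    apply add_nonneg
    · exact Real.iSup_nonneg fun s => Real.iSup_nonneg fun _ =>
        add_nonneg (add_nonneg (mul_nonneg hi (L2Sq_nonneg _)) (L2Sq_nonneg _))
          (mul_nonneg hi (L2Sq_nonneg _))
    · exact intervalIntegral.integral_nonneg hT fun s _ =>
        add_nonneg (dSq_nonneg _ _) (mul_nonneg hi (dSq_nonneg _ _))
  have a4 : (ε ^ 2)⁻¹ * dSq 2 (φ t) + dSq 2 (ψ t) + (ε ^ 2)⁻¹ * dSq 2 (θ t) ≤ A4 ε φ ψ θ T := by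
    obtain ⟨B1, h1⟩ := slice_bound 2 ψ hψ T
    obtain ⟨B2, h2⟩ := slice_bound 2 φ hφ T
    obtain ⟨B3, h3⟩ := slice_bound 2 θ hθ T
    have h := le_sup (fun s => (ε ^ 2)⁻¹ * dSq 2 (φ s) + dSq 2 (ψ s) + (ε ^ 2)⁻¹ * dSq 2 (θ s)) T
      ((ε ^ 2)⁻¹ * B2 + B1 + (ε ^ 2)⁻¹ * B3) (fun s hs => by
        have := h1 s hs
        have := h2 s hs
        have := h3 s hs
        gcongr) t ht
    have h' : 0 ≤ ∫ s in (0 : ℝ)..T,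
        ((ε ^ 4)⁻¹ * HSq 2 (φ s) + HSq 3 (ψ s) + (ε ^ 2)⁻¹ * HSq 3 (θ s)) :=
      intervalIntegral.integral_nonneg hT fun s _ =>
        add_nonneg (add_nonneg (mul_nonneg (by positivity) (HSq_nonneg _ _)) (HSq_nonneg _ _))
          (mul_nonneg hi (HSq_nonneg _ _))
    unfold A4
    linarith
  have a5 : (ε ^ 2)⁻¹ * dSq 3 (φ t) + dSq 3 (ψ t) + (ε ^ 2)⁻¹ * dSq 3 (θ t) ≤ A5 ε φ ψ θ T := by
    obtain ⟨B1, h1⟩ := slice_bound 3 ψ hψ T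
    obtain ⟨B2, h2⟩ := slice_bound 3 φ hφ T
    obtain ⟨B3, h3⟩ := slice_bound 3 θ hθ T
    obtain ⟨B4, h4⟩ := slice_bound 1 (dt ψ) (smooth_dt ψ hψ) T
    obtain ⟨B5, h5⟩ := slice_bound 1 (dt θ) (smooth_dt θ hθ) T
    have h := le_sup (fun s => (ε ^ 2)⁻¹ * dSq 3 (φ s) + (dSq 3 (ψ s) + dSq 1 (dt ψ s))
        + (ε ^ 2)⁻¹ * (dSq 3 (θ s) + dSq 1 (dt θ s))) T
      ((ε ^ 2)⁻¹ * B2 + (B1 + B4) + (ε ^ 2)⁻¹ * (B3 + B5)) (fun s hs => by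
        have := h1 s hs
        have := h2 s hs
        have := h3 s hs
        have := h4 s hs
        have := h5 s hs
        gcongr) t ht
    have h' : 0 ≤ ∫ s in (0 : ℝ)..T, (L2Sq (dt (dt ψ) s) + (ε ^ 2)⁻¹ * L2Sq (dt (dt θ) s)) :=
      intervalIntegral.integral_nonneg hT fun s _ =>
        add_nonneg (L2Sq_nonneg _) (mul_nonneg hi (L2Sq_nonneg _))
    have n1 := dSq_nonneg 1 (dt ψ t)
    have n2 := mul_nonneg hi (dSq_nonneg 1 (dt θ t))
    unfold A5
    linarith
  unfold Nfun
  have a3' : 0 ≤ ε ^ 2 * A3 ε φ ψ θ T := by positivity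
  have : (ε ^ 2)⁻¹ * (dSq 0 (ψ t) + (ε ^ 2)⁻¹ * dSq 0 (φ t) + (ε ^ 2)⁻¹ * dSq 0 (θ t))
      ≤ (ε ^ 2)⁻¹ * A0 ε φ ψ θ T := by gcongr
  have : ε ^ 2 * ((ε ^ 2)⁻¹ * dSq 2 (φ t) + dSq 2 (ψ t) + (ε ^ 2)⁻¹ * dSq 2 (θ t))
      ≤ ε ^ 2 * A4 ε φ ψ θ T := by gcongr
  have : ε ^ 4 * ((ε ^ 2)⁻¹ * dSq 3 (φ t) + dSq 3 (ψ t) + (ε ^ 2)⁻¹ * dSq 3 (θ t))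
      ≤ ε ^ 4 * A5 ε φ ψ θ T := by gcongr
  linarith

/-- Sobolev bound for a field whose derivatives scale like powers of `ε`. -/
lemma sob_scaled (f : ℝ × ℝ → E) (hf : ContDiff ℝ 2 f) (ε M : ℝ) (x : ℝ × ℝ) (hx : x ∈ Ω)
    (hε : 0 < ε) (hε1 : ε < 1) (h0 : (ε ^ 2)⁻¹ * dSq 0 f ≤ M) (h1 : dSq 1 f ≤ M)
    (h2 : ε ^ 2 * dSq 2 f ≤ M) : ‖f x‖ ^ 2 ≤ 16 * M := by
  have := sob_Ω f hf ε x hx hε hε1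
  linarith

lemma dSq_fderiv (j : ℕ) (f : ℝ × ℝ → E) : dSq j (fderiv ℝ f) = dSq (j + 1) f := by
  unfold dSq
  simp_rw [norm_iteratedFDeriv_fderiv]

lemma iter_eq (f : ℕ → ℝ → ℝ) (N : ℕ)
    (hd : ∀ n < N, ∀ y ∈ Set.Ioo (0 : ℝ) 1, HasDerivAt (f n) (f (n + 1) y) y) (n : ℕ) :
    n ≤ N → ∀ y ∈ Set.Ioo (0 : ℝ) 1, iteratedDeriv n (f 0) y = f n y := by
  induction n with
  | zero => intro _ y _; simp
  | succ n ih =>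
    intro hn y hy
    rw [iteratedDeriv_succ]
    have : iteratedDeriv n (f 0) =ᶠ[𝓝 y] f n := by
      filter_upwards [isOpen_Ioo.mem_nhds hy] with z hz
      exact ih (by omega) z hz
    rw [this.deriv_eq]
    exact (hd n (by omega) y hy).deriv

lemma snd_bound (f : ℕ → ℝ → ℝ) (δ : ℝ) (hδ : 0 ≤ δ)
    (hd : ∀ n < 4, ∀ y ∈ Set.Ioo (0 : ℝ) 1, HasDerivAt (f n) (f (n + 1) y) y)
    (hb : ∀ n ≤ 4, ∀ y ∈ Set.Ioo (0 : ℝ) 1, |f n y| ≤ δ)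
    (hc : ContDiffOn ℝ 4 (f 0) (Set.Ioo 0 1)) :
    LinfSup (fun x : ℝ × ℝ => f 0 x.2) ≤ δ ∧
      Real.sqrt (HSq 4 (fun x : ℝ × ℝ => f 0 x.2)) ≤ 6 * δ := by
  constructor
  · apply sup_le _ _ hδ
    intro x hx
    exact hb 0 (by norm_num) x.2 hx.2
  have key : ∀ j ≤ 4, dSq j (fun x : ℝ × ℝ => f 0 x.2) ≤ δ ^ 2 * (2 * π) := by
    intro j hj
    apply dSq_le_of_bound
    intro x hx
    set L := ContinuousLinearMap.snd ℝ ℝ ℝ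
    have hL : ‖L‖ ≤ 1 := ContinuousLinearMap.norm_snd_le ..
    have ho : IsOpen (L ⁻¹' Set.Ioo (0 : ℝ) 1) := isOpen_Ioo.preimage L.continuous
    have e := L.iteratedFDerivWithin_comp_right hc isOpen_Ioo.uniqueDiffOn ho.uniqueDiffOn
      (x := x) hx.2 (i := j) (by exact_mod_cast hj)
    rw [iteratedFDerivWithin_of_isOpen j ho (show x ∈ L ⁻¹' Set.Ioo (0 : ℝ) 1 from hx.2),
      iteratedFDerivWithin_of_isOpen j isOpen_Ioo (show L x ∈ Set.Ioo (0 : ℝ) 1 from hx.2)] at e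
    change ‖iteratedFDeriv ℝ j (f 0 ∘ L) x‖ ≤ δ
    rw [e]
    refine (ContinuousMultilinearMap.norm_compContinuousLinearMap_le _ _).trans ?_
    rw [Finset.prod_const, Finset.card_univ, Fintype.card_fin,
      norm_iteratedFDeriv_eq_norm_iteratedDeriv, iter_eq f 4 hd j hj (L x) hx.2]
    have h1 := hb j hj (L x) hx.2
    have h2 : ‖L‖ ^ j ≤ 1 := pow_le_one₀ (norm_nonneg _) hL
    calc ‖f j (L x)‖ * ‖L‖ ^ j ≤ δ * 1 := by
          apply mul_le_mul h1 h2 (by positivity) hδ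
      _ = δ := mul_one _
  have hs : HSq 4 (fun x : ℝ × ℝ => f 0 x.2) ≤ 5 * (δ ^ 2 * (2 * π)) := by
    unfold HSq
    refine (Finset.sum_le_card_nsmul _ _ (δ ^ 2 * (2 * π)) ?_).trans (le_of_eq ?_)
    · intro j hj
      exact key j (by have := Finset.mem_range.1 hj; omega)
    · simp
  apply Real.sqrt_le_iff.2 ⟨by positivity, ?_⟩
  have := Real.pi_lt_d2
  nlinarith [sq_nonneg δ]

set_option maxHeartbeats 2000000 in
lemma couette_bounds (γ Pr Kχ ε χ : ℝ) (hγ : 1 < γ) (hPr : 0 < Pr) (hK : 0 < Kχ) (hε : 0 < ε)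
    (hε1 : ε ≤ 1) (hχ : |1 - χ| ≤ Kχ * ε) (hs : (Kχ + Pr) * ε ≤ 1 / 8) :
    (∀ x ∈ Ω, 3 / 4 < tρ γ Pr ε χ x ∧ 3 / 4 < tT γ Pr ε χ x) ∧
      LinfSup (fun x => tρ γ Pr ε χ x - 1) ≤ 2000 * ((Kχ + Pr) * ε) ∧
      Real.sqrt (HSq 4 (fun x => tρ γ Pr ε χ x - 1)) ≤ 6 * (2000 * ((Kχ + Pr) * ε)) ∧
      LinfSup (fun x => tT γ Pr ε χ x - 1) ≤ (Kχ + Pr) * ε ∧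
      Real.sqrt (HSq 4 (fun x => tT γ Pr ε χ x - 1)) ≤ 6 * ((Kχ + Pr) * ε) := by
  set k := ε ^ 2 * Pr / (2 * (γ / (γ - 1))) with hk
  set d := (Kχ + Pr) * ε with hd
  have hd0 : 0 < d := by positivity
  have hg1 : 1 ≤ γ / (γ - 1) := by rw [le_div_iff₀ (by linarith)]; linarith
  have hk0 : 0 ≤ k := by positivity
  have hk1 : 2 * k ≤ Pr * ε := by
    have : k ≤ ε ^ 2 * Pr / (2 * 1) := by rw [hk]; gcongr
    have : ε ^ 2 ≤ ε := by nlinarith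
    nlinarith
  set q : ℝ → ℝ := fun y => χ + (1 - χ) * y - k * (y ^ 2 - y) with hq
  set q1 : ℝ → ℝ := fun y => (1 - χ) - k * (2 * y - 1) with hq1
  set q2 : ℝ := -(2 * k) with hq2
  have eT : ∀ x, tT γ Pr ε χ x = q x.2 := fun x => rfl
  obtain ⟨hχ1, hχ2⟩ := abs_le.1 hχ
  have hKd : Kχ * ε + Pr * ε = d := by rw [hd]; ring
  have hKe : 0 < Kχ * ε := by positivity
  have hPe : 0 < Pr * ε := by positivity
  have b0 : ∀ y ∈ Set.Ioo (0 : ℝ) 1, |q y - 1| ≤ d := by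
    rintro y ⟨hy0, hy1⟩
    have : q y - 1 = -((1 - χ) * (1 - y)) + k * (y * (1 - y)) := by simp only [hq]; ring
    rw [this, abs_le]
    have h1 : 0 ≤ y * (1 - y) := by nlinarith
    have h2 : y * (1 - y) ≤ 1 := by nlinarith
    constructor <;> nlinarith
  have b1 : ∀ y ∈ Set.Ioo (0 : ℝ) 1, |q1 y| ≤ d := by
    rintro y ⟨hy0, hy1⟩
    simp only [hq1]
    rw [abs_le]
    constructor <;> nlinarith
  have b2 : |q2| ≤ d := by
    rw [hq2, abs_neg, abs_of_nonneg (by positivity)]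
    linarith
  have D0 : ∀ y, HasDerivAt q (q1 y) y := by
    intro y
    have h := (((hasDerivAt_id y).const_mul (1 - χ)).const_add χ).sub
      ((((hasDerivAt_id y).pow 2).sub (hasDerivAt_id y)).const_mul k)
    refine h.congr_deriv ?_
    simp [hq1]
  have D1 : ∀ y, HasDerivAt q1 q2 y := by
    intro y
    have h := ((((hasDerivAt_id y).const_mul 2).sub_const 1).const_mul k).const_sub (1 - χ)
    refine h.congr_deriv ?_
    simp [hq2]; ring
  have qlow : ∀ y ∈ Set.Ioo (0 : ℝ) 1, 7 / 8 ≤ q y ∧ q y ≤ 9 / 8 := by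
    intro y hy
    have := abs_le.1 (b0 y hy)
    constructor <;> linarith
  have qinv : ∀ y ∈ Set.Ioo (0 : ℝ) 1, 3 / 4 < (q y)⁻¹ ∧ (q y)⁻¹ ≤ 2 := by
    intro y hy
    obtain ⟨h1, h2⟩ := qlow y hy
    constructor
    · rw [lt_inv_comm₀ (by norm_num) (by linarith)]; norm_num; linarith
    · rw [inv_le_comm₀ (by linarith) (by norm_num)]; norm_num; linarith
  have qcd : ContDiff ℝ 4 q := by simp only [hq]; fun_prop
  refine ⟨fun x hx => ⟨(qinv x.2 hx.2).1, ?_⟩, ?_⟩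
  · rw [eT]; linarith [(qlow x.2 hx.2).1]
  have S1 := snd_bound (fun n => match n with
      | 0 => fun y => (q y)⁻¹ - 1
      | 1 => fun y => -(q1 y * (q y)⁻¹ ^ 2)
      | 2 => fun y => -(q2 * (q y)⁻¹ ^ 2) + 2 * (q1 y ^ 2 * (q y)⁻¹ ^ 3)
      | 3 => fun y => 6 * (q1 y * q2 * (q y)⁻¹ ^ 3) - 6 * (q1 y ^ 3 * (q y)⁻¹ ^ 4)
      | _ => fun y => 6 * (q2 ^ 2 * (q y)⁻¹ ^ 3) - 36 * (q1 y ^ 2 * q2 * (q y)⁻¹ ^ 4)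
          + 24 * (q1 y ^ 4 * (q y)⁻¹ ^ 5)) (2000 * d) (by positivity)
    (by
      intro n hn y hy
      have hq0 : q y ≠ 0 := by have := (qlow y hy).1; linarith
      have W : HasDerivAt (fun y => (q y)⁻¹) (-(q1 y * (q y)⁻¹ ^ 2)) y := by
        refine ((D0 y).inv hq0).congr_deriv ?_
        field_simp
      interval_cases n
      · exact W.sub_const 1
      · refine ((D1 y).mul (W.pow 2)).neg.congr_deriv ?_
        simp; ring
      · refine (((W.pow 2).const_mul q2).neg.add
          ((((D1 y).pow 2).mul (W.pow 3)).const_mul 2)).congr_deriv ?_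
        simp; ring
      · refine (((((D1 y).mul_const q2).mul (W.pow 3)).const_mul 6).sub
          ((((D1 y).pow 3).mul (W.pow 4)).const_mul 6)).congr_deriv ?_
        simp; ring)
    (by
      intro n hn y hy
      obtain ⟨w1, w2⟩ := qinv y hy
      have hq0 : q y ≠ 0 := by have := (qlow y hy).1; linarith
      have B0 := b0 y hy
      have B1 := b1 y hy
      have hw : |(q y)⁻¹| ≤ 2 := by rw [abs_of_nonneg (by linarith)]; exact w2
      have hd1 : d ≤ 1 := by linarith
      have P : ∀ i : ℕ, |(q y)⁻¹| ^ i ≤ 2 ^ i := fun i => by gcongr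
      have hd2 : d ^ 2 ≤ d := by nlinarith
      have hd3 : d ^ 3 ≤ d := by nlinarith [sq_nonneg d]
      have hd4 : d ^ 4 ≤ d := by nlinarith [sq_nonneg d, sq_nonneg (d ^ 2)]
      have X : ∀ (i j l : ℕ), |q1 y ^ i * q2 ^ j * (q y)⁻¹ ^ l| ≤ d ^ i * d ^ j * 2 ^ l := by
        intro i j l
        rw [abs_mul, abs_mul, abs_pow, abs_pow, abs_pow]
        gcongr
      interval_cases n
      · have : (q y)⁻¹ - 1 = (1 - q y) * (q y)⁻¹ := by field_simp
        change |(q y)⁻¹ - 1| ≤ _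
        rw [this, abs_mul, abs_sub_comm]
        have : |q y - 1| * |(q y)⁻¹| ≤ d * 2 := by gcongr
        linarith
      · have x1 := abs_le.1 (X 1 0 2)
        simp only [pow_zero, pow_one, mul_one, one_mul] at x1
        change |-(q1 y * (q y)⁻¹ ^ 2)| ≤ _
        rw [abs_le]
        constructor <;> linarith
      · have x1 := abs_le.1 (X 0 1 2)
        have x2 := abs_le.1 (X 2 0 3)
        simp only [pow_zero, pow_one, mul_one, one_mul] at x1 x2
        change |-(q2 * (q y)⁻¹ ^ 2) + 2 * (q1 y ^ 2 * (q y)⁻¹ ^ 3)| ≤ _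
        rw [abs_le]
        constructor <;> linarith
      · have x1 := abs_le.1 (X 1 1 3)
        have x2 := abs_le.1 (X 3 0 4)
        simp only [pow_zero, pow_one, mul_one, one_mul] at x1 x2
        change |6 * (q1 y * q2 * (q y)⁻¹ ^ 3) - 6 * (q1 y ^ 3 * (q y)⁻¹ ^ 4)| ≤ _
        rw [abs_le]
        constructor <;> linarith
      · have x1 := abs_le.1 (X 0 2 3)
        have x2 := abs_le.1 (X 2 1 4)
        have x3 := abs_le.1 (X 4 0 5)
        simp only [pow_zero, pow_one, mul_one, one_mul] at x1 x2 x3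
        change |6 * (q2 ^ 2 * (q y)⁻¹ ^ 3) - 36 * (q1 y ^ 2 * q2 * (q y)⁻¹ ^ 4)
          + 24 * (q1 y ^ 4 * (q y)⁻¹ ^ 5)| ≤ _
        rw [abs_le]
        constructor <;> linarith)
    (by
      refine ContDiffOn.sub (ContDiffOn.inv qcd.contDiffOn ?_) contDiffOn_const
      intro y hy
      have := (qlow y hy).1
      linarith)
  have S2 := snd_bound (fun n => match n with
      | 0 => fun y => q y - 1
      | 1 => q1
      | 2 => fun _ => q2
      | _ => fun _ => 0) d hd0.le
    (by
      intro n hn y hy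
      interval_cases n
      · exact (D0 y).sub_const 1
      · exact D1 y
      · exact hasDerivAt_const _ _
      · exact hasDerivAt_const _ _)
    (by
      intro n hn y hy
      interval_cases n
      · exact b0 y hy
      · exact b1 y hy
      · exact b2
      · simpa using hd0.le
      · simpa using hd0.le)
    (qcd.sub contDiff_const).contDiffOn
  exact ⟨S1.1, S1.2, S2.1, S2.2⟩

end Helpers

set_option maxHeartbeats 2000000 in
/-- elementary pointwise bounds on the Couette flow and on small
solutions. -/
theorem couette_flow_and_solution_bounds (γ Pr r Kχ : ℝ)
    (hγ : 1 < γ) (hPr : 0 < Pr) (hr : 0 < 1 + r) (hK : 0 < Kχ) :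
    ∃ ε₀ C : ℝ, 0 < ε₀ ∧ 0 < C ∧
      ∀ ε χ : ℝ, 0 < ε → ε ≤ 1 → 0 < χ → |1 - χ| ≤ Kχ * ε → |1 - χ| ≤ 1 / 2 →
        ε < ε₀ →
        ((∀ x ∈ Ω, 3 / 4 < tρ γ Pr ε χ x ∧ 3 / 4 < tT γ Pr ε χ x) ∧
          LinfSup (fun x => tρ γ Pr ε χ x - 1) ≤ C * ε ∧
          Real.sqrt (HSq 4 (fun x => tρ γ Pr ε χ x - 1)) ≤ C * ε ∧
          LinfSup (fun x => tT γ Pr ε χ x - 1) ≤ C * ε ∧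
          Real.sqrt (HSq 4 (fun x => tT γ Pr ε χ x - 1)) ≤ C * ε) ∧
        ∀ (Re T : ℝ) (S : PerturbSol γ Pr r Re ε χ T),
          0 < Re → 0 ≤ T → SmoothSol S → StdHyp S →
          Nfun ε S.φ S.ψ S.θ T ≤ 1 →
          ∀ t ∈ Set.Icc (0 : ℝ) T,
            (∀ x ∈ Ω, 1 / 2 < pρ γ Pr ε χ S.φ t x ∧ 1 / 2 < pT γ Pr ε χ S.θ t x) ∧
            (⨆ x ∈ Ω, ((S.φ t x) ^ 2 + (S.θ t x) ^ 2))
                ≤ C * Nfun ε S.φ S.ψ S.θ T * ε ^ 2 ∧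
            (⨆ x ∈ Ω, ‖S.ψ t x‖ ^ 2) ≤ C * Nfun ε S.φ S.ψ S.θ T ∧
            (⨆ x ∈ Ω, (‖grad (S.φ t) x‖ ^ 2 + ‖grad (S.θ t) x‖ ^ 2))
                ≤ C * Nfun ε S.φ S.ψ S.θ T ∧
            (⨆ x ∈ Ω, ‖fderiv ℝ (S.ψ t) x‖ ^ 2)
                ≤ C * Nfun ε S.φ S.ψ S.θ T * (ε ^ 2)⁻¹ := by
  set m := Kχ + Pr with hm
  have hm0 : 0 < m := by positivity
  refine ⟨min (1 / 16) (1 / (8 * m)), 12000 * m + 32, by positivity, by positivity, ?_⟩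
  intro ε χ hε hε1 _ hχ _ hε0
  have hε16 : ε < 1 / 16 := hε0.trans_le (min_le_left _ _)
  have hs : m * ε ≤ 1 / 8 := by
    have h := (hε0.trans_le (min_le_right _ _)).le
    rw [le_div_iff₀ (by positivity)] at h
    linarith
  have hme : 0 < m * ε := by positivity
  obtain ⟨c0, c1, c2, c3, c4⟩ := couette_bounds γ Pr Kχ ε χ hγ hPr hK hε hε1 hχ hs
  rw [← hm] at c1 c2 c3 c4
  refine ⟨⟨c0, by linarith, by linarith, by linarith, by linarith⟩, ?_⟩
  intro Re T S _ hT hsm _ hN t ht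
  obtain ⟨sφ, sψ, sθ⟩ := hsm
  have EN := energy_lower ε T hε hT S.φ S.ψ S.θ sφ sψ sθ t ht
  set N := Nfun ε S.φ S.ψ S.θ T with hNdef
  have hε2 : (0 : ℝ) < ε ^ 2 := by positivity
  have hi : ε ^ 2 * (ε ^ 2)⁻¹ = 1 := mul_inv_cancel₀ hε2.ne'
  have hi0 : 0 < (ε ^ 2)⁻¹ := by positivity
  set e := ε ^ 2 with he
  have he4 : ε ^ 4 = e * e := by rw [he]; ring
  rw [he4] at EN
  set i := e⁻¹ with hidef
  have p0 := dSq_nonneg 0 (S.φ t)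
  have p1 := dSq_nonneg 1 (S.φ t)
  have p2 := dSq_nonneg 2 (S.φ t)
  have p3 := dSq_nonneg 3 (S.φ t)
  have r0 := dSq_nonneg 0 (S.ψ t)
  have r1 := dSq_nonneg 1 (S.ψ t)
  have r2 := dSq_nonneg 2 (S.ψ t)
  have r3 := dSq_nonneg 3 (S.ψ t)
  have u0 := dSq_nonneg 0 (S.θ t)
  have u1 := dSq_nonneg 1 (S.θ t)
  have u2 := dSq_nonneg 2 (S.θ t)
  have u3 := dSq_nonneg 3 (S.θ t)
  set P0 := dSq 0 (S.φ t) with hP0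
  set P1 := dSq 1 (S.φ t) with hP1
  set P2 := dSq 2 (S.φ t) with hP2
  set P3 := dSq 3 (S.φ t) with hP3
  set R0 := dSq 0 (S.ψ t) with hR0
  set R1 := dSq 1 (S.ψ t) with hR1
  set R2 := dSq 2 (S.ψ t) with hR2
  set R3 := dSq 3 (S.ψ t) with hR3
  set U0 := dSq 0 (S.θ t) with hU0
  set U1 := dSq 1 (S.θ t) with hU1
  set U2 := dSq 2 (S.θ t) with hU2
  set U3 := dSq 3 (S.θ t) with hU3
  have EN' : i * R0 + i * (i * P0) + i * (i * U0) + R1 + i * U1 + i * P1 + P2 + e * R2 + U2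
      + e * P3 + e * (e * R3) + e * U3 ≤ N := by
    refine le_trans (le_of_eq ?_) EN
    linear_combination (-(P2 + U2 + e * P3 + e * U3)) * hi
  have n1 : 0 ≤ i * R0 := by positivity
  have n2 : 0 ≤ i * (i * P0) := by positivity
  have n3 : 0 ≤ i * (i * U0) := by positivity
  have n4 : 0 ≤ i * U1 := by positivity
  have n5 : 0 ≤ i * P1 := by positivity
  have n6 : 0 ≤ e * R2 := by positivity
  have n7 : 0 ≤ e * P3 := by positivity
  have n8 : 0 ≤ e * (e * R3) := by positivity
  have n9 : 0 ≤ e * U3 := by positivity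
  have hN0 : 0 ≤ N := by linarith
  have mulE : ∀ z, i * z ≤ N → z ≤ N * e := by
    intro z hz
    have h := mul_le_mul_of_nonneg_left hz hε2.le
    have h' : e * (i * z) = z := by rw [← mul_assoc, hi, one_mul]
    linarith
  have mulI : ∀ z, e * z ≤ N → z ≤ N * i := by
    intro z hz
    have h := mul_le_mul_of_nonneg_left hz hi0.le
    have h' : i * (e * z) = z := by rw [← mul_assoc, mul_comm i, hi, one_mul]
    linarith
  have hε1' : ε < 1 := by linarith
  have cφ := smooth_slice S.φ sφ t
  have cψ := smooth_slice S.ψ sψ t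
  have cθ := smooth_slice S.θ sθ t
  have le2 : (2 : WithTop ℕ∞) ≤ ((⊤ : ℕ∞) : WithTop ℕ∞) := WithTop.coe_le_coe.2 (le_top : (2 : ℕ∞) ≤ ⊤)
  have le3 : (2 : WithTop ℕ∞) + 1 ≤ ((⊤ : ℕ∞) : WithTop ℕ∞) :=
    WithTop.coe_le_coe.2 (le_top : (2 + 1 : ℕ∞) ≤ ⊤)
  have bφ : ∀ x ∈ Ω, ‖S.φ t x‖ ^ 2 ≤ 16 * (N * e) := fun x hx =>
    sob_scaled (S.φ t) (cφ.of_le le2) ε (N * e) x hx hε hε1'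
      (mulE _ (by linarith)) (mulE _ (by linarith))
      (by rw [mul_comm N]; exact mul_le_mul_of_nonneg_left (by linarith) hε2.le)
  have bθ : ∀ x ∈ Ω, ‖S.θ t x‖ ^ 2 ≤ 16 * (N * e) := fun x hx =>
    sob_scaled (S.θ t) (cθ.of_le le2) ε (N * e) x hx hε hε1'
      (mulE _ (by linarith)) (mulE _ (by linarith))
      (by rw [mul_comm N]; exact mul_le_mul_of_nonneg_left (by linarith) hε2.le)
  have bψ : ∀ x ∈ Ω, ‖S.ψ t x‖ ^ 2 ≤ 16 * N := fun x hx =>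
    sob_scaled (S.ψ t) (cψ.of_le le2) ε N x hx hε hε1'
      (by linarith) (by linarith) (by linarith)
  have bdφ : ∀ x ∈ Ω, ‖fderiv ℝ (S.φ t) x‖ ^ 2 ≤ 16 * N := fun x hx =>
    sob_scaled (fderiv ℝ (S.φ t)) (cφ.fderiv_right le3) ε N x hx hε hε1'
      (by rw [dSq_fderiv]; linarith) (by rw [dSq_fderiv]; linarith)
      (by rw [dSq_fderiv]; linarith)
  have bdθ : ∀ x ∈ Ω, ‖fderiv ℝ (S.θ t) x‖ ^ 2 ≤ 16 * N := fun x hx =>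
    sob_scaled (fderiv ℝ (S.θ t)) (cθ.fderiv_right le3) ε N x hx hε hε1'
      (by rw [dSq_fderiv]; linarith) (by rw [dSq_fderiv]; linarith)
      (by rw [dSq_fderiv]; linarith)
  have bdψ : ∀ x ∈ Ω, ‖fderiv ℝ (S.ψ t) x‖ ^ 2 ≤ 16 * (N * i) := fun x hx =>
    sob_scaled (fderiv ℝ (S.ψ t)) (cψ.fderiv_right le3) ε (N * i) x hx hε hε1'
      (by
        rw [dSq_fderiv, mul_comm N]
        exact mul_le_mul_of_nonneg_left (by linarith) hi0.le)
      (by rw [dSq_fderiv]; exact mulI _ (by linarith))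
      (by rw [dSq_fderiv]; exact mulI _ (by linarith))
  have gle : ∀ (f : ℝ × ℝ → ℝ) (x : ℝ × ℝ), ‖grad f x‖ ^ 2 ≤ ‖fderiv ℝ f x‖ ^ 2 := by
    intro f x
    have h := norm_d_le1 f x
    rw [norm_iteratedFDeriv_one] at h
    have : ‖grad f x‖ ≤ ‖fderiv ℝ f x‖ := max_le h.1 h.2
    gcongr
  have hNe : 0 ≤ N * e := by positivity
  have hNi : 0 ≤ N * i := by positivity
  have q1 : 0 ≤ m * N := by positivity
  have q2 : 0 ≤ m * N * e := by positivity
  have q3 : 0 ≤ m * N * i := by positivity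
  have small : 16 * (N * e) < (1 / 4) ^ 2 := by
    have h1 : N * e ≤ e := mul_le_of_le_one_left hε2.le hN
    have h2 : e < 1 / 256 := by rw [he]; nlinarith
    linarith
  refine ⟨fun x hx => ?_, ?_, ?_, ?_, ?_⟩
  · have h1 : |S.φ t x| < 1 / 4 :=
      lt_of_pow_lt_pow_left₀ 2 (by norm_num) ((bφ x hx).trans_lt small)
    have h2 : |S.θ t x| < 1 / 4 :=
      lt_of_pow_lt_pow_left₀ 2 (by norm_num) ((bθ x hx).trans_lt small)
    have h3 := c0 x hx
    have h4 := abs_lt.1 h1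
    have h5 := abs_lt.1 h2
    unfold pρ pT
    constructor
    · linarith [h3.1, h4.1]
    · linarith [h3.2, h5.1]
  · apply sup_le _ _ (by positivity)
    intro x hx
    have h1 := bφ x hx
    have h2 := bθ x hx
    rw [Real.norm_eq_abs, sq_abs] at h1 h2
    linarith
  · apply sup_le _ _ (by positivity)
    intro x hx
    have h1 := bψ x hx
    linarith
  · apply sup_le _ _ (by positivity)
    intro x hx
    have h1 := (gle _ _).trans (bdφ x hx)
    have h2 := (gle _ _).trans (bdθ x hx)
    linarith
  · apply sup_le _ _ (by positivity)
    intro x hx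
    have h1 := bdψ x hx
    linarith
end Couette
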